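/- Let G be an almost Moore digraph of degree d > 1 and diameter k > 1 with self-repeats and let α > 1 be an integer. If H_α is different from the directed k-cycle C_k of self-repeats, then H_α has diameter exactly k. -/

import Mathlib

/-- `IsWalkFrom A u v l` : the list `u :: l` is a directed walk from `u` to `v`
along the adjacency relation `A`; the length of the walk is `l.length`. -/
def IsWalkFrom {V : Type} (A : V → V → Prop) (u v : V) (l : List V) : Prop :=
  List.Chain A u l ∧ (u :: l).getLast (List.cons_ne_nil u l) = v

/-- An almost Moore digraph (a `(d,k)`-digraph): a diregular digraph of degree `d > 1`,
diameter `k > 1` and order `d + d² + ⋯ + d^k`, together with its repeat permutation `rep`: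
for every vertex `v`, every vertex `w ≠ rep v` is reached from `v` by exactly one walk of
length at most `k`, while `rep v` is reached by exactly two such walks, at least one of
which has length `k`.  The map `rep` is an automorphism of the digraph. -/
structure AlmostMooreDigraph (d k : ℕ) where
  hd : 1 < d
  hk : 1 < k
  V : Type
  [fintypeV : Fintype V]
  [decEqV : DecidableEq V]
  Adj : V → V → Prop
  [adjDec : DecidableRel Adj]
  loopless : ∀ v, ¬ Adj v v
  out_deg : ∀ v, {w | Adj v w}.ncard = d
  in_deg : ∀ v, {w | Adj w v}.ncard = d
  reach : ∀ u v, ∃ l, IsWalkFrom Adj u v l ∧ l.length ≤ k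
  diam : ∃ u v, ∀ l, IsWalkFrom Adj u v l → k ≤ l.length
  card_eq : Fintype.card V = ∑ i ∈ Finset.range k, d ^ (i + 1)
  rep : V → V
  rep_spec : ∀ v w, w ≠ rep v → ∃! l, IsWalkFrom Adj v w l ∧ l.length ≤ k
  rep_two : ∀ v, ∃ l₁ l₂, l₁ ≠ l₂ ∧
      IsWalkFrom Adj v (rep v) l₁ ∧ l₁.length ≤ k ∧
      IsWalkFrom Adj v (rep v) l₂ ∧ l₂.length ≤ k ∧
      (l₁.length = k ∨ l₂.length = k) ∧
      (∀ l, IsWalkFrom Adj v (rep v) l → l.length ≤ k → l = l₁ ∨ l = l₂)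
  rep_bijective : Function.Bijective rep
  rep_adj : ∀ u v, Adj u v ↔ Adj (rep u) (rep v)

attribute [instance] AlmostMooreDigraph.fintypeV AlmostMooreDigraph.decEqV
  AlmostMooreDigraph.adjDec

/-- `ordRep M v` : the smallest `t ≥ 1` with `rep^t v = v`. -/
noncomputable def ordRep {d k : ℕ} (M : AlmostMooreDigraph d k) (v : M.V) : ℕ :=
  sInf {t | 0 < t ∧ M.rep^[t] v = v}

/-- The vertex set of the subdigraph `H_α`: vertices whose order under the repeat
permutation divides `2^t * α` for some `t ≥ 0`. -/
def Hset {d k : ℕ} (M : AlmostMooreDigraph d k) (α : ℕ) : Set M.V :=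
  {v | ∃ t : ℕ, ordRep M v ∣ 2 ^ t * α}

open Function

theorem isWalkFrom_nil {V : Type} {A : V → V → Prop} {u v : V} :
    IsWalkFrom A u v [] ↔ u = v :=
  ⟨fun h => h.2, fun h => ⟨List.IsChain.singleton u, h⟩⟩

theorem isWalkFrom_cons {V : Type} {A : V → V → Prop} {u v a : V} {l : List V} :
    IsWalkFrom A u v (a :: l) ↔ A u a ∧ IsWalkFrom A a v l := by
  constructor
  · rintro ⟨h, hv⟩
    obtain ⟨ha, hl⟩ := List.isChain_cons_cons.1 h
    exact ⟨ha, hl, by simpa using hv⟩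
  · rintro ⟨ha, hl, hv⟩
    exact ⟨List.isChain_cons_cons.2 ⟨ha, hl⟩, by simpa using hv⟩

theorem IsWalkFrom.map {V : Type} {A : V → V → Prop} {f : V → V}
    (hf : ∀ u v, A u v → A (f u) (f v)) {u v : V} {l : List V} (h : IsWalkFrom A u v l) :
    IsWalkFrom A (f u) (f v) (l.map f) := by
  induction l generalizing u with
  | nil => exact isWalkFrom_nil.2 (congrArg f (isWalkFrom_nil.1 h))
  | cons a l ih =>
    obtain ⟨ha, hl⟩ := isWalkFrom_cons.1 h
    exact isWalkFrom_cons.2 ⟨hf _ _ ha, ih hl⟩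

theorem IsWalkFrom.append {V : Type} {A : V → V → Prop} {u v w : V} {l l' : List V}
    (h : IsWalkFrom A u v l) (h' : IsWalkFrom A v w l') : IsWalkFrom A u w (l ++ l') := by
  induction l generalizing u with
  | nil =>
    obtain rfl := isWalkFrom_nil.1 h
    simpa using h'
  | cons a l ih =>
    obtain ⟨ha, hl⟩ := isWalkFrom_cons.1 h
    exact isWalkFrom_cons.2 ⟨ha, ih hl⟩

theorem IsWalkFrom.exists_take {V : Type} {A : V → V → Prop} {u v : V} {l : List V}
    (h : IsWalkFrom A u v l) (n : ℕ) :
    ∃ x ∈ u :: l, IsWalkFrom A u x (l.take n) := by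
  refine ⟨(u :: l.take n).getLast (List.cons_ne_nil _ _), ?_, ?_, rfl⟩
  · exact List.take_subset (n + 1) (u :: l) (List.getLast_mem (List.cons_ne_nil u (l.take n)))
  · exact List.IsChain.take h.1 (n + 1)

theorem IsWalkFrom.target_mem {V : Type} {A : V → V → Prop} {u v : V} {l : List V}
    (h : IsWalkFrom A u v l) : v ∈ u :: l := by
  rw [← h.2]
  exact List.getLast_mem _

namespace AlmostMooreDigraph

variable {d k : ℕ} (M : AlmostMooreDigraph d k)

theorem ordRep_eq_minimalPeriod (v : M.V) : ordRep M v = minimalPeriod M.rep v := by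
  have hv : v ∈ periodicPts M.rep := M.rep_bijective.1.mem_periodicPts v
  refine le_antisymm (Nat.sInf_le ⟨minimalPeriod_pos_of_mem_periodicPts hv,
    iterate_minimalPeriod⟩) (le_csInf ?_ ?_)
  · exact ⟨_, minimalPeriod_pos_of_mem_periodicPts hv, iterate_minimalPeriod⟩
  · rintro t ⟨ht, h⟩
    exact IsPeriodicPt.minimalPeriod_le ht h

theorem mem_Hset_iff {α : ℕ} {v : M.V} :
    v ∈ Hset M α ↔ ∃ t : ℕ, IsPeriodicPt M.rep (2 ^ t * α) v := by
  simp only [Hset, Set.mem_ofPred_eq, ordRep_eq_minimalPeriod, isPeriodicPt_iff_minimalPeriod_dvd]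

theorem rep_mem_Hset {α : ℕ} {v : M.V} (hv : v ∈ Hset M α) : M.rep v ∈ Hset M α := by
  rw [mem_Hset_iff] at hv ⊢
  obtain ⟨t, ht⟩ := hv
  exact ⟨t, ht.apply⟩

theorem mem_Hset_of_rep_eq {α : ℕ} {v : M.V} (hv : M.rep v = v) : v ∈ Hset M α :=
  M.mem_Hset_iff.2 ⟨0, IsFixedPt.isPeriodicPt hv _⟩

theorem adj_iterate_rep (n : ℕ) (u v : M.V) (h : M.Adj u v) :
    M.Adj (M.rep^[n] u) (M.rep^[n] v) := by
  induction n with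
  | zero => exact h
  | succ n ih =>
    rw [iterate_succ_apply', iterate_succ_apply']
    exact (M.rep_adj _ _).1 ih

theorem map_map_eq_of_isWalkFrom {n : ℕ} {u v : M.V} (hu : IsPeriodicPt M.rep n u)
    (hv : IsPeriodicPt M.rep n v) {l : List M.V} (h : IsWalkFrom M.Adj u v l)
    (hl : l.length ≤ k) : (l.map M.rep^[n]).map M.rep^[n] = l := by
  have key : ∀ l : List M.V, IsWalkFrom M.Adj u v l → l.length ≤ k →
      IsWalkFrom M.Adj u v (l.map M.rep^[n]) ∧ (l.map M.rep^[n]).length ≤ k := by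
    intro l h hl
    have h' := h.map (M.adj_iterate_rep n)
    rw [hu.eq, hv.eq] at h'
    exact ⟨h', by simpa using hl⟩
  by_cases hvu : v = M.rep u
  · subst hvu
    obtain ⟨l₁, l₂, hne, h₁, hl₁, h₂, hl₂, -, hall⟩ := M.rep_two u
    have inj : Injective (List.map M.rep^[n]) :=
      List.map_injective_iff.2 (M.rep_bijective.1.iterate n)
    have hne' : l₁.map M.rep^[n] ≠ l₂.map M.rep^[n] := fun h => hne (inj h)
    have k₁ := hall _ (key l₁ h₁ hl₁).1 (key l₁ h₁ hl₁).2
    have k₂ := hall _ (key l₂ h₂ hl₂).1 (key l₂ h₂ hl₂).2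
    rcases hall l h hl with rfl | rfl <;> grind
  · have hun := (M.rep_spec u v hvu).unique (key l h hl) ⟨h, hl⟩
    rw [hun, hun]

theorem mem_Hset_of_isWalkFrom {α : ℕ} {u v : M.V} (hu : u ∈ Hset M α) (hv : v ∈ Hset M α)
    {l : List M.V} (h : IsWalkFrom M.Adj u v l) (hl : l.length ≤ k) :
    ∀ w ∈ u :: l, w ∈ Hset M α := by
  intro w hw
  rcases List.mem_cons.1 hw with rfl | hw
  · exact hu
  obtain ⟨s, hs⟩ := M.mem_Hset_iff.1 hu
  obtain ⟨t, ht⟩ := M.mem_Hset_iff.1 hv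
  have hs' : IsPeriodicPt M.rep (2 ^ (s + t) * α) u :=
    hs.trans_dvd (mul_dvd_mul_right (pow_dvd_pow 2 (Nat.le_add_right s t)) α)
  have ht' : IsPeriodicPt M.rep (2 ^ (s + t) * α) v :=
    ht.trans_dvd (mul_dvd_mul_right (pow_dvd_pow 2 (Nat.le_add_left t s)) α)
  have hmap := M.map_map_eq_of_isWalkFrom hs' ht' h hl
  rw [List.map_map] at hmap
  have hw' : (M.rep^[2 ^ (s + t) * α] ∘ M.rep^[2 ^ (s + t) * α]) w = w :=
    List.map_inj_left.1 (hmap.trans (List.map_id l).symm) w hw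
  refine M.mem_Hset_iff.2 ⟨s + t + 1, ?_⟩
  rw [← iterate_add] at hw'
  rwa [IsPeriodicPt, IsFixedPt, pow_succ, mul_comm _ 2, mul_assoc, two_mul]

theorem rep_eq_of_mem_closed_walk {v : M.V} (hv : M.rep v = v) {l : List M.V}
    (h : IsWalkFrom M.Adj v v l) (hl : l.length ≤ k) : ∀ w ∈ l, M.rep w = w := by
  have hmap : IsWalkFrom M.Adj v v (l.map M.rep) := by
    simpa [hv] using h.map (fun a b => (M.rep_adj a b).1)
  have hnil : IsWalkFrom M.Adj v v [] := isWalkFrom_nil.2 rfl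
  obtain ⟨l₁, l₂, -, -, -, -, -, -, hall⟩ := M.rep_two v
  rw [hv] at hall
  have h₀ := hall [] hnil (by simp)
  have h₁ := hall l h hl
  have h₂ := hall _ hmap (by simpa using hl)
  have hlen : (l.map M.rep).length = l.length := List.length_map _
  have : l.map M.rep = l := by
    by_cases hl0 : l = []
    · simp [hl0]
    · have : l.map M.rep ≠ [] := by simpa using hl0
      grind
  exact List.map_inj_left.1 (this.trans (List.map_id l).symm)

theorem exists_isWalkFrom_rep (v : M.V) :
    ∃ l, IsWalkFrom M.Adj v (M.rep v) l ∧ l.length = k := by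
  obtain ⟨l₁, l₂, -, h₁, -, h₂, -, h | h, -⟩ := M.rep_two v
  exacts [⟨l₁, h₁, h⟩, ⟨l₂, h₂, h⟩]

end AlmostMooreDigraph

/-- Let `G` be an almost Moore digraph with self-repeats.  If `H_α` is
different from the directed `k`-cycle `C_k` of self-repeats, then `H_α` has diameter
exactly `k`: every pair of vertices of `H_α` is joined by a walk of length at most `k`
inside `H_α`, and some pair of vertices of `H_α` admits no walk inside `H_α` of length
less than `k`. -/
theorem stmt7 {d k : ℕ} (M : AlmostMooreDigraph d k) (hsr : ∃ v, M.rep v = v)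
    (α : ℕ) (hα : 1 < α) (hne : Hset M α ≠ {v | M.rep v = v}) :
    (∀ u ∈ Hset M α, ∀ v ∈ Hset M α,
      ∃ l : List M.V, IsWalkFrom M.Adj u v l ∧ l.length ≤ k ∧
        ∀ w ∈ u :: l, w ∈ Hset M α) ∧
    (∃ u ∈ Hset M α, ∃ v ∈ Hset M α,
      ∀ l : List M.V, IsWalkFrom M.Adj u v l → (∀ w ∈ u :: l, w ∈ Hset M α) →
        k ≤ l.length) := by
  refine ⟨fun u hu v hv => ?_, ?_⟩
  · obtain ⟨l, h, hl⟩ := M.reach u v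
    exact ⟨l, h, hl, M.mem_Hset_of_isWalkFrom hu hv h hl⟩
  · by_contra! hcon
    refine hne (Set.Subset.antisymm (fun w hw => ?_) fun w hw => M.mem_Hset_of_rep_eq hw)
    obtain ⟨v, hv⟩ := hsr
    have hvH : v ∈ Hset M α := M.mem_Hset_of_rep_eq hv
    obtain ⟨l, h, -, hl⟩ := hcon v hvH w hw
    obtain ⟨l', h', hl'⟩ := M.exists_isWalkFrom_rep w
    obtain ⟨x, hx, hwx⟩ := h'.exists_take (k - l.length)
    have hxH := M.mem_Hset_of_isWalkFrom hw (M.rep_mem_Hset hw) h' hl'.le x hx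
    have hlong := h.append hwx
    have hlen : (l ++ l'.take (k - l.length)).length = k := by
      simp only [List.length_append, List.length_take]
      lia
    have hxv : x = v := by
      by_contra hne'
      obtain ⟨s, hs, -, hsl⟩ := hcon v hvH x hxH
      have heq := (M.rep_spec v x (by rwa [hv])).unique ⟨hs, hsl.le⟩ ⟨hlong, hlen.le⟩
      rw [heq, hlen] at hsl
      exact lt_irrefl _ hsl
    subst hxv
    rcases List.mem_cons.1 h.target_mem with rfl | hwl
    · exact hv
    · exact M.rep_eq_of_mem_closed_walk hv hlong hlen.le w (List.mem_append_left _ hwl)
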